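/- Let Q be the exponential mechanism on a finite output set Y with score s : U × Y → ℝ that is L-Lipschitz in u (|s(u1,y) − s(u2,y)| ≤ L·d(u1,u2) for all y), outputting y with probability proportional to e^{s(u,y)}. Then for all u1,u2 ∈ U and all y ∈ Y, P(Qu1 = y) ≤ e^{2L·d(u1,u2)} P(Qu2 = y), and moreover the factor 2 cannot in general be replaced by any constant c < 2 (there exist U, s, u1, u2, y for which P(Qu1 = y) > e^{cL·d(u1,u2)} P(Qu2 = y)). -/

import Mathlib

open Real

/-- Output probability of the exponential mechanism with score `s` on a finite
output set `Y`. -/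
noncomputable def expMechProb {U Y : Type*} [Fintype Y] (s : U → Y → ℝ) (u : U) (y : Y) : ℝ :=
  Real.exp (s u y) / ∑ y' : Y, Real.exp (s u y')

lemma expMechProb_le_exp_mul {U Y : Type*} [Fintype Y] [Nonempty Y] (s : U → Y → ℝ)
    {u₁ u₂ : U} {D : ℝ} (h : ∀ y, |s u₁ y - s u₂ y| ≤ D) (y : Y) :
    expMechProb s u₁ y ≤ exp (2 * D) * expMechProb s u₂ y := by
  have hpos (u : U) : 0 < ∑ y', exp (s u y') :=
    Finset.sum_pos (fun _ _ ↦ exp_pos _) Finset.univ_nonempty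
  have hnum : exp (s u₁ y) ≤ exp D * exp (s u₂ y) := by
    rw [← exp_add]
    exact exp_le_exp.mpr (by linarith [(abs_le.mp (h y)).2])
  have hden : ∑ y', exp (s u₂ y') ≤ exp D * ∑ y', exp (s u₁ y') := by
    rw [Finset.mul_sum]
    refine Finset.sum_le_sum fun y' _ ↦ ?_
    rw [← exp_add]
    exact exp_le_exp.mpr (by linarith [(abs_le.mp (h y')).1])
  unfold expMechProb
  rw [mul_div_assoc', div_le_div_iff₀ (hpos u₁) (hpos u₂)]
  calc exp (s u₁ y) * ∑ y', exp (s u₂ y')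
      ≤ (exp D * exp (s u₂ y)) * (exp D * ∑ y', exp (s u₁ y')) :=
        mul_le_mul hnum hden (hpos u₂).le (by positivity)
    _ = exp (2 * D) * exp (s u₂ y) * ∑ y', exp (s u₁ y') := by
        rw [two_mul, exp_add]
        ring

/-- Two outputs whose scores move in opposite directions at unit speed. -/
noncomputable def opposedScore (a v : ℝ) : Bool → ℝ
  | true => v
  | false => a - v

lemma abs_opposedScore_sub (a v₁ v₂ : ℝ) (y : Bool) :
    |opposedScore a v₁ y - opposedScore a v₂ y| = dist v₁ v₂ := by
  cases y
  · rw [opposedScore, opposedScore, sub_sub_sub_cancel_left, abs_sub_comm, Real.dist_eq]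
  · rw [opposedScore, opposedScore, Real.dist_eq]

lemma exists_exp_mul_expMechProb_opposedScore_lt {c : ℝ} (hc : c < 2) :
    ∃ a, exp c * expMechProb (opposedScore a) 0 true < expMechProb (opposedScore a) 1 true := by
  have hgap : 0 < 1 - exp (c - 2) := sub_pos.mpr (exp_lt_one_iff.mpr (by linarith))
  obtain ⟨a, ha⟩ : ∃ a, exp a = exp c / (1 - exp (c - 2)) :=
    ⟨_, exp_log (by positivity)⟩
  have hmul : exp a * (1 - exp (c - 2)) = exp c := by
    rw [ha, div_mul_cancel₀ _ hgap.ne']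
  refine ⟨a, ?_⟩
  simp only [expMechProb, opposedScore, Fintype.sum_bool, exp_zero, sub_zero]
  rw [mul_one_div, div_lt_div_iff₀ (by positivity) (by positivity)]
  have hexp : exp c * exp (a - 1) = exp 1 * (exp a * exp (c - 2)) := by
    simp only [← exp_add]
    congr 1
    ring
  nlinarith [exp_pos 1]

/-- The exponential mechanism with `L`-Lipschitz score satisfies a pointwise
`2L`-geographic DP bound, and the factor `2` cannot in general be replaced by
any constant `c < 2`. -/
theorem exponential_mechanism_geoDP_and_tight
    {U : Type*} [MetricSpace U] {Y : Type*} [Fintype Y] [Nonempty Y]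
    (s : U → Y → ℝ) (L : ℝ) (hL : 0 ≤ L)
    (hLip : ∀ u₁ u₂ : U, ∀ y : Y, |s u₁ y - s u₂ y| ≤ L * dist u₁ u₂) :
    (∀ u₁ u₂ : U, ∀ y : Y,
        expMechProb s u₁ y ≤ Real.exp (2 * L * dist u₁ u₂) * expMechProb s u₂ y) ∧
    (∀ c : ℝ, c < 2 → ∃ (L' : ℝ) (s' : ℝ → Bool → ℝ) (u₁ u₂ : ℝ) (y : Bool),
        0 < L' ∧
        (∀ v₁ v₂ : ℝ, ∀ y' : Bool, |s' v₁ y' - s' v₂ y'| ≤ L' * dist v₁ v₂) ∧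
        Real.exp (c * L' * dist u₁ u₂) * expMechProb s' u₂ y < expMechProb s' u₁ y) := by
  refine ⟨fun u₁ u₂ y ↦ ?_, fun c hc ↦ ?_⟩
  · rw [mul_assoc]
    exact expMechProb_le_exp_mul s (hLip u₁ u₂) y
  · obtain ⟨a, ha⟩ := exists_exp_mul_expMechProb_opposedScore_lt hc
    refine ⟨1, opposedScore a, 1, 0, true, one_pos, fun v₁ v₂ y ↦ ?_, ?_⟩
    · rw [abs_opposedScore_sub, one_mul]
    · simpa using ha
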